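/- For every field k there exists a field K together with a field embedding of k into K such that K is pseudo-algebraically closed and k is algebraically closed in K: every element of K which is algebraic over k lies in the image of k. -/

import Mathlib

universe u

/-- A field `K` is pseudo-algebraically closed if every geometrically integral variety
over `K` has a `K`-rational point: for every finitely generated `K`-algebra `A` which is
an integral domain and stays an integral domain after base change to an algebraic closure
of `K`, there is a `K`-algebra homomorphism `A → K`. -/
def IsPseudoAlgClosed (K : Type u) [Field K] : Prop :=
  ∀ (A : Type u) [CommRing A] [IsDomain A] [Algebra K A],
    Algebra.FiniteType K A →
    IsDomain (TensorProduct K (AlgebraicClosure K) A) →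
    Nonempty (A →ₐ[K] K)

open scoped TensorProduct

theorem IsAlgClosed.exists_algHom_apply_ne_zero {k B : Type*} [Field k] [IsAlgClosed k]
    [CommRing B] [IsDomain B] [Algebra k B] [Algebra.FiniteType k B] {c : B} (hc : c ≠ 0) :
    ∃ φ : B →ₐ[k] k, φ c ≠ 0 := by
  let C := Localization.Away c
  have : Nontrivial C :=
    (IsLocalization.injective C (powers_le_nonZeroDivisors_of_noZeroDivisors hc)).nontrivial
  have hC : Algebra.FiniteType B C := IsLocalization.finiteType_of_monoid_fg (.powers c) C
  have : Algebra.FiniteType k C := .trans ‹_› hC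
  obtain ⟨m, hm⟩ := Ideal.exists_maximal C
  let _ : Field (C ⧸ m) := Ideal.Quotient.field m
  have : Module.Finite k (C ⧸ m) := finite_of_finite_type_of_isJacobsonRing k (C ⧸ m)
  let e : k ≃ₐ[k] (C ⧸ m) := .ofBijective (Algebra.ofId k _)
    IsAlgClosed.algebraMap_bijective_of_isIntegral
  let φ : C →ₐ[k] k := e.symm.toAlgHom.comp (Ideal.Quotient.mkₐ k m)
  refine ⟨φ.comp (IsScalarTower.toAlgHom k B C), ?_⟩
  exact ((IsLocalization.Away.algebraMap_isUnit (S := C) c).map φ).ne_zero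

/-- A tensor product of integral domains over an algebraically closed field is a domain. -/
theorem IsAlgClosed.isDomain_tensorProduct (k A B : Type*) [Field k] [IsAlgClosed k]
    [CommRing A] [IsDomain A] [Algebra k A] [CommRing B] [IsDomain B] [Algebra k B] :
    IsDomain (B ⊗[k] A) := by
  have : Nontrivial (B ⊗[k] A) :=
    (Algebra.TensorProduct.includeRight_injective (R := k) (A := B) (B := A)
      (algebraMap k B).injective).nontrivial
  suffices NoZeroDivisors (B ⊗[k] A) from NoZeroDivisors.to_isDomain _
  refine ⟨fun {x y} hxy ↦ ?_⟩
  by_contra! h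
  obtain ⟨B₁, hB₁, x₁, rfl⟩ := TensorProduct.Algebra.exists_of_fg x
  obtain ⟨B₂, hB₂, y₂, rfl⟩ := TensorProduct.Algebra.exists_of_fg y
  let B' := B₁ ⊔ B₂
  have : Algebra.FiniteType k B' := B'.fg_iff_finiteType.1 (hB₁.sup hB₂)
  let ι := Algebra.TensorProduct.map B'.val (AlgHom.id k A)
  have hι : Function.Injective ι :=
    Module.Flat.rTensor_preserves_injective_linearMap B'.val.toLinearMap Subtype.val_injective
  let x := Algebra.TensorProduct.map
    (Subalgebra.inclusion (le_sup_left : B₁ ≤ B')) (AlgHom.id k A) x₁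
  let y := Algebra.TensorProduct.map
    (Subalgebra.inclusion (le_sup_right : B₂ ≤ B')) (AlgHom.id k A) y₂
  have hx : ι x = LinearMap.rTensor A B₁.val.toLinearMap x₁ := by
    rw [← AlgHom.comp_apply, ← Algebra.TensorProduct.map_comp]; rfl
  have hy : ι y = LinearMap.rTensor A B₂.val.toLinearMap y₂ := by
    rw [← AlgHom.comp_apply, ← Algebra.TensorProduct.map_comp]; rfl
  rw [← hx, ← hy] at h hxy
  rw [← map_mul, map_eq_zero_iff ι hι] at hxy
  rw [map_ne_zero_iff ι hι, map_ne_zero_iff ι hι] at h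
  let b := Module.Basis.ofVectorSpace k A
  let bB := Algebra.TensorProduct.basis B' b
  obtain ⟨i, hi⟩ : ∃ i, bB.repr x i ≠ 0 := by
    by_contra! h'
    exact h.1 (bB.repr.map_eq_zero_iff.1 (Finsupp.ext h'))
  obtain ⟨j, hj⟩ : ∃ j, bB.repr y j ≠ 0 := by
    by_contra! h'
    exact h.2 (bB.repr.map_eq_zero_iff.1 (Finsupp.ext h'))
  obtain ⟨φ, hφ⟩ := IsAlgClosed.exists_algHom_apply_ne_zero (k := k) (mul_ne_zero hi hj)
  rw [map_mul, mul_ne_zero_iff] at hφ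
  let ψ : B' ⊗[k] A →ₐ[k] A := Algebra.TensorProduct.lift ((Algebra.ofId k A).comp φ)
    (AlgHom.id k A) fun _ _ ↦ Commute.all _ _
  have key (z : B' ⊗[k] A) (l) : b.repr (ψ z) l = φ (bB.repr z l) := by
    induction z with
    | zero => simp
    | add z w hz hw => simp [hz, hw]
    | tmul c a => simp [ψ, bB, Algebra.ofId_apply, ← Algebra.smul_def, mul_comm (φ c)]
  have h0 : ψ x * ψ y = 0 := by rw [← map_mul, hxy, map_zero]
  rcases mul_eq_zero.1 h0 with h0 | h0
  · exact hφ.1 (by rw [← key, h0]; simp)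
  · exact hφ.2 (by rw [← key, h0]; simp)

/-- An algebra over a field is geometrically integral if its base change to an algebraic closure
is an integral domain. -/
abbrev IsGeometricallyIntegral (K A : Type*) [Field K] [CommRing A] [Algebra K A] : Prop :=
  IsDomain (AlgebraicClosure K ⊗[K] A)

namespace IsGeometricallyIntegral

theorem baseChange (K L A : Type*) [Field K] [Field L] [Algebra K L] [CommRing A] [Algebra K A]
    [IsGeometricallyIntegral K A] : IsGeometricallyIntegral L (L ⊗[K] A) := by
  let _ : Algebra (AlgebraicClosure K) (AlgebraicClosure L) :=
    (IsAlgClosed.lift : AlgebraicClosure K →ₐ[K] AlgebraicClosure L).toRingHom.toAlgebra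
  have : IsScalarTower K (AlgebraicClosure K) (AlgebraicClosure L) :=
    .of_algebraMap_eq fun x ↦
      ((IsAlgClosed.lift : AlgebraicClosure K →ₐ[K] AlgebraicClosure L).commutes x).symm
  have := IsAlgClosed.isDomain_tensorProduct (AlgebraicClosure K) (AlgebraicClosure K ⊗[K] A)
    (AlgebraicClosure L)
  let e := Algebra.TensorProduct.cancelBaseChange K L L (AlgebraicClosure L) A
  let e' := Algebra.TensorProduct.cancelBaseChange K (AlgebraicClosure K) (AlgebraicClosure K)
    (AlgebraicClosure L) A
  exact (e.toRingEquiv.trans e'.symm.toRingEquiv).injective.isDomain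

theorem of_baseChange (K L A : Type*) [Field K] [Field L] [Algebra K L] [CommRing A] [Algebra K A]
    [IsGeometricallyIntegral L (L ⊗[K] A)] : IsGeometricallyIntegral K A := by
  let e := Algebra.TensorProduct.cancelBaseChange K L L (AlgebraicClosure L) A
  have : IsDomain (AlgebraicClosure L ⊗[K] A) := e.symm.injective.isDomain
  let f : AlgebraicClosure K →ₐ[K] AlgebraicClosure L := IsAlgClosed.lift
  have hf : Function.Injective (Algebra.TensorProduct.map f (AlgHom.id K A)) :=
    Module.Flat.rTensor_preserves_injective_linearMap f.toLinearMap f.injective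
  exact hf.isDomain

theorem of_algEquiv {K A B : Type*} [Field K] [CommRing A] [Algebra K A] [CommRing B] [Algebra K B]
    [IsGeometricallyIntegral K A] (e : A ≃ₐ[K] B) : IsGeometricallyIntegral K B :=
  (Algebra.TensorProduct.congr (.refl : AlgebraicClosure K ≃ₐ[K] _) e).symm.injective.isDomain

theorem isDomain (K A : Type*) [Field K] [CommRing A] [Algebra K A]
    [IsGeometricallyIntegral K A] : IsDomain A :=
  (Algebra.TensorProduct.includeRight_injective (R := K) (A := AlgebraicClosure K) (B := A)
    (algebraMap K _).injective).isDomain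

/-- A field is relatively algebraically closed in the function field of a geometrically integral
algebra. -/
theorem isIntegrallyClosedIn_fractionRing (K A F : Type*) [Field K] [CommRing A] [Algebra K A]
    [IsGeometricallyIntegral K A] [Field F] [Algebra A F] [IsFractionRing A F] [Algebra K F]
    [IsScalarTower K A F] : IsIntegrallyClosedIn K F := by
  rw [isIntegrallyClosedIn_iff]
  refine ⟨(algebraMap K F).injective, fun {x} hx ↦ ?_⟩
  let Ω := AlgebraicClosure K
  have : IsDomain A := isDomain K A
  have : IsDomain (Ω ⊗[K] F) := by
    let f : Ω ⊗[K] A →ₐ[Ω] Ω ⊗[K] F :=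
      Algebra.TensorProduct.map (.id Ω Ω) (IsScalarTower.toAlgHom K A F)
    let _ : Algebra (Ω ⊗[K] A) (Ω ⊗[K] F) := f.toRingHom.toAlgebra
    have : IsScalarTower Ω (Ω ⊗[K] A) (Ω ⊗[K] F) := .of_algebraMap_eq fun x ↦ (f.commutes x).symm
    have := IsLocalization.tensorProduct_tensorProduct_right K Ω (nonZeroDivisors A) F <| by
      ext a
      simp [RingHom.algebraMap_toAlgebra, f]
    refine IsLocalization.isDomain_of_le_nonZeroDivisors (Ω ⊗[K] F)
      (M := (nonZeroDivisors A).map (Algebra.TensorProduct.includeRight (R := K) (A := Ω))) ?_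
    exact map_le_nonZeroDivisors_of_injective _ (Algebra.TensorProduct.includeRight_injective
      (algebraMap K Ω).injective) le_rfl
  let ι : F →ₐ[K] Ω ⊗[K] F := Algebra.TensorProduct.includeRight
  have h0 : Polynomial.aeval (ι x) ((minpoly K x).map (algebraMap K Ω)) = 0 := by
    rw [Polynomial.aeval_map_algebraMap, Polynomial.aeval_algHom_apply, minpoly.aeval, map_zero]
  rw [(IsAlgClosed.splits ((minpoly K x).map (algebraMap K Ω))).eq_prod_roots_of_monic
    ((minpoly.monic hx).map _), map_multiset_prod, Multiset.prod_eq_zero_iff] at h0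
  simp only [Multiset.map_map, Multiset.mem_map] at h0
  obtain ⟨α, -, hα⟩ := h0
  have hα : (1 : Ω) ⊗ₜ[K] x = α ⊗ₜ[K] 1 := by
    simpa [sub_eq_zero, ι, Algebra.TensorProduct.algebraMap_apply] using hα
  let N := LinearMap.range (Algebra.linearMap K F)
  have h1 : N.mkQ 1 = 0 := (Submodule.Quotient.mk_eq_zero N).2 ⟨1, by simp⟩
  have hN : (1 : Ω) ⊗ₜ[K] N.mkQ x = 0 := by
    simpa [h1] using congrArg (N.mkQ.lTensor Ω) hα
  have : N.mkQ x = 0 :=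
    (Module.FaithfullyFlat.one_tmul_eq_zero_iff K (F ⧸ N) (N.mkQ x) (A := Ω)).1 hN
  simpa [N] using this

end IsGeometricallyIntegral

theorem IsIntegrallyClosedIn.trans_field (K L M : Type*) [Field K] [Field L] [Field M] [Algebra K L]
    [Algebra L M] [Algebra K M] [IsScalarTower K L M] [IsIntegrallyClosedIn K L]
    [IsIntegrallyClosedIn L M] : IsIntegrallyClosedIn K M := by
  refine isIntegrallyClosedIn_iff.2 ⟨(algebraMap K M).injective, fun {x} hx ↦ ?_⟩
  obtain ⟨y, rfl⟩ := IsIntegrallyClosedIn.isIntegral_iff.1 (hx.tower_top (A := L))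
  rw [isIntegral_algebraMap_iff (algebraMap L M).injective] at hx
  obtain ⟨z, rfl⟩ := IsIntegrallyClosedIn.isIntegral_iff.1 hx
  exact ⟨z, IsScalarTower.algebraMap_apply K L M z⟩

/-- Finitely many geometrically integral algebras acquire points in a common extension in which
the base field is relatively algebraically closed. -/
theorem exists_extension_algHom_finset {K : Type u} [Field K] {I : Type*} (A : I → Type u)
    [∀ i, CommRing (A i)] [∀ i, Algebra K (A i)] [∀ i, IsGeometricallyIntegral K (A i)]
    (S : Finset I) :
    ∃ (L : Type u) (_ : Field L) (_ : Algebra K L), IsIntegrallyClosedIn K L ∧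
      ∀ i ∈ S, Nonempty (A i →ₐ[K] L) := by
  classical
  induction S using Finset.induction with
  | empty =>
    exact ⟨K, inferInstance, inferInstance,
      isIntegrallyClosedIn_iff.2 ⟨Function.injective_id, fun {x} _ ↦ ⟨x, rfl⟩⟩, by simp⟩
  | insert i S _ ih =>
    obtain ⟨L, _, _, hL, hS⟩ := ih
    have := IsGeometricallyIntegral.baseChange K L (A i)
    have := IsGeometricallyIntegral.isDomain L (L ⊗[K] A i)
    let F := FractionRing (L ⊗[K] A i)
    have := IsGeometricallyIntegral.isIntegrallyClosedIn_fractionRing L (L ⊗[K] A i) F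
    refine ⟨F, inferInstance, inferInstance, .trans_field K L F, ?_⟩
    rw [Finset.forall_mem_insert]
    refine ⟨⟨(IsScalarTower.toAlgHom K (L ⊗[K] A i) F).comp
      Algebra.TensorProduct.includeRight⟩, fun j hj ↦ ?_⟩
    obtain ⟨φ⟩ := hS j hj
    exact ⟨(IsScalarTower.toAlgHom K L F).comp φ⟩

/-- A field is relatively algebraically closed in every residue field of a product of extensions
in which it is relatively algebraically closed. -/
theorem isIntegrallyClosedIn_pi_quotient {K I : Type*} [Field K] (L : I → Type*)
    [∀ i, Field (L i)] [∀ i, Algebra K (L i)] [∀ i, IsIntegrallyClosedIn K (L i)]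
    (M : Ideal (∀ i, L i)) [M.IsPrime] : IsIntegrallyClosedIn K ((∀ i, L i) ⧸ M) := by
  classical
  refine isIntegrallyClosedIn_iff.2 ⟨(algebraMap K _).injective, fun {x} hx ↦ ?_⟩
  obtain ⟨x, rfl⟩ := Ideal.Quotient.mk_surjective x
  obtain ⟨p, hp, hpx⟩ := hx
  let q : Polynomial K := ∏ a ∈ p.roots.toFinset, (Polynomial.X - Polynomial.C a)
  have hpM : Polynomial.aeval x p ∈ M := by
    rw [← Ideal.Quotient.eq_zero_iff_mem, ← hpx, ← Polynomial.aeval_def]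
    exact (Polynomial.aeval_algHom_apply (Ideal.Quotient.mkₐ K M) x p).symm
  have hroot (i) (hi : Polynomial.aeval (x i) p = 0) : Polynomial.aeval (x i) q = 0 := by
    obtain ⟨a, ha⟩ := IsIntegrallyClosedIn.isIntegral_iff.1 (⟨p, hp, hi⟩ : IsIntegral K (x i))
    rw [← ha, Polynomial.aeval_algebraMap_apply, Polynomial.coe_aeval_eq_eval,
      map_eq_zero_iff _ (algebraMap K (L i)).injective] at hi ⊢
    rw [Polynomial.eval_prod]
    exact Finset.prod_eq_zero (Multiset.mem_toFinset.2 ((Polynomial.mem_roots hp.ne_zero).2 hi))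
      (by simp)
  have hcomp (r : Polynomial K) (i) : Polynomial.aeval x r i = Polynomial.aeval (x i) r :=
    (Polynomial.aeval_algHom_apply (Pi.evalAlgHom K L i) x r).symm
  have hqM : Polynomial.aeval x q ∈ M := by
    have : Polynomial.aeval x q =
        (fun i ↦ Polynomial.aeval (x i) q / Polynomial.aeval (x i) p) * Polynomial.aeval x p := by
      ext i
      rw [Pi.mul_apply, hcomp, hcomp, div_mul_cancel_of_imp (hroot i)]
    rw [this]
    exact M.mul_mem_left _ hpM
  rw [map_prod, Ideal.IsPrime.prod_mem_iff] at hqM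
  obtain ⟨a, -, ha⟩ := hqM
  refine ⟨a, (Ideal.Quotient.eq.2 ?_).symm⟩
  simpa using ha

/-- The extensions given by finite subfamilies are glued by passing to a residue field of their
product, at a maximal ideal containing all families that vanish on large finite sets. -/
theorem exists_extension_algHom_family {K : Type u} [Field K] {I : Type u} (A : I → Type u)
    [∀ i, CommRing (A i)] [∀ i, Algebra K (A i)] [∀ i, IsGeometricallyIntegral K (A i)] :
    ∃ (L : Type u) (_ : Field L) (_ : Algebra K L), IsIntegrallyClosedIn K L ∧
      ∀ i, Nonempty (A i →ₐ[K] L) := by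
  classical
  choose L _ _ _ hLA using exists_extension_algHom_finset (K := K) A
  let φ S i hi := (hLA S i hi).some
  let J : Ideal (∀ S, L S) :=
    { carrier := {x | ∃ S₀, ∀ S, S₀ ⊆ S → x S = 0}
      zero_mem' := ⟨∅, fun _ _ ↦ rfl⟩
      add_mem' := by
        rintro x y ⟨S, hS⟩ ⟨T, hT⟩
        refine ⟨S ∪ T, fun U hU ↦ ?_⟩
        simp [hS U (Finset.union_subset_left hU), hT U (Finset.union_subset_right hU)]
      smul_mem' := by
        rintro x y ⟨S, hS⟩
        exact ⟨S, fun U hU ↦ by simp [hS U hU]⟩ }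
  have hJ : J ≠ ⊤ := by
    rw [Ne, Ideal.eq_top_iff_one]
    rintro ⟨S, hS⟩
    exact one_ne_zero (hS S subset_rfl)
  obtain ⟨M, hM, hJM⟩ := J.exists_le_maximal hJ
  let _ : Field ((∀ S, L S) ⧸ M) := Ideal.Quotient.field M
  refine ⟨(∀ S, L S) ⧸ M, inferInstance, inferInstance, isIntegrallyClosedIn_pi_quotient L M,
    fun i ↦ ⟨?_⟩⟩
  let g (a : A i) (S : Finset I) : L S := if h : i ∈ S then φ S i h a else 0
  have hg {x y : ∀ S, L S} (h : ∀ S, i ∈ S → x S = y S) :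
      Ideal.Quotient.mk M x = Ideal.Quotient.mk M y :=
    Ideal.Quotient.eq.2 <| hJM ⟨{i}, fun S hS ↦ sub_eq_zero.2 (h S (by simpa using hS))⟩
  exact
    { toFun a := Ideal.Quotient.mk M (g a)
      map_one' := hg fun S hS ↦ by simp [g, hS]
      map_mul' a b := by rw [← map_mul]; exact hg fun S hS ↦ by simp [g, hS]
      map_zero' := hg fun S hS ↦ by simp [g, hS]
      map_add' a b := by rw [← map_add]; exact hg fun S hS ↦ by simp [g, hS]
      commutes' r := hg fun S hS ↦ by simp [g, hS] }

theorem exists_extension_forall_algHom (K : Type u) [Field K] :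
    ∃ (L : Type u) (_ : Field L) (_ : Algebra K L), IsIntegrallyClosedIn K L ∧
      ∀ (A : Type u) [CommRing A] [Algebra K A], Algebra.FiniteType K A →
        IsGeometricallyIntegral K A → Nonempty (A →ₐ[K] L) := by
  let I := {p : Σ n : ℕ, Ideal (MvPolynomial (Fin n) K) //
    IsGeometricallyIntegral K (MvPolynomial (Fin p.1) K ⧸ p.2)}
  have (p : I) : IsGeometricallyIntegral K (MvPolynomial (Fin p.1.1) K ⧸ p.1.2) := p.2
  obtain ⟨L, _, _, hL, h⟩ := exists_extension_algHom_family (K := K)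
    fun p : I ↦ MvPolynomial (Fin p.1.1) K ⧸ p.1.2
  refine ⟨L, _, _, hL, fun A _ _ hA _ ↦ ?_⟩
  obtain ⟨n, f, hf⟩ := Algebra.FiniteType.iff_quotient_mvPolynomial''.1 hA
  let e := (Ideal.quotientKerAlgEquivOfSurjective hf).symm
  obtain ⟨φ⟩ := h ⟨⟨n, RingHom.ker f⟩, .of_algEquiv e⟩
  exact ⟨φ.comp e.toAlgHom⟩

/-- A sequence of fields and embeddings has a union. -/
theorem exists_direct_limit_nat (F : ℕ → Type u) [∀ n, Field (F n)] (f : ∀ n, F n →+* F (n + 1)) :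
    ∃ (K : Type u) (_ : Field K) (g : ∀ n, F n →+* K),
      (∀ n x, g (n + 1) (f n x) = g n x) ∧ ∀ x, ∃ n y, g n y = x := by
  let t (i j : ℕ) (h : i ≤ j) : F i →+* F j :=
    Nat.leRecOn h (fun {n} φ ↦ (f n).comp φ) (RingHom.id (F i))
  have ht (i j : ℕ) (h : i ≤ j) : ⇑(t i j h) = Nat.leRecOn h (fun {n} ↦ f n) := by
    induction j, h using Nat.le_induction with
    | base => ext; simp [t, Nat.leRecOn_self]
    | succ j h ih =>
      ext x
      simp only [t] at ih ⊢
      rw [Nat.leRecOn_succ h, Nat.leRecOn_succ h, RingHom.comp_apply, ih]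
  have : DirectedSystem F fun i j h ↦ t i j h :=
    ⟨fun i x ↦ by simp [ht, Nat.leRecOn_self], fun i j k hij hjk x ↦ by
      simp [ht, Nat.leRecOn_trans hij hjk]⟩
  refine ⟨DirectLimit F t, inferInstance, DirectLimit.Ring.of F t, fun n x ↦ ?_, fun x ↦ ?_⟩
  · rw [← DirectLimit.Ring.of_f n.le_succ, ht]
    exact congrArg _ (Nat.leRecOn_succ' (next := fun {n} ↦ f n) x).symm
  · obtain ⟨n, y, rfl⟩ := DirectLimit.exists_eq_mk t x
    exact ⟨n, y, rfl⟩

/-- For every field `k` there is a field extension `K` of `k` which is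
pseudo-algebraically closed and in which `k` is algebraically closed: every element of
`K` algebraic over `k` lies in the image of `k`. -/
theorem exists_pseudo_alg_closed_extension (k : Type u) [Field k] :
    ∃ (K : Type u) (_ : Field K) (ι : k →+* K),
      IsPseudoAlgClosed K ∧
      ∀ x : K, (∃ p : Polynomial k, p ≠ 0 ∧ Polynomial.eval₂ ι x p = 0) →
        x ∈ Set.range ι := by
  choose N fieldN algN closedN pointN using @exists_extension_forall_algHom.{u}
  let X : ℕ → Σ T : Type u, Field T :=
    Nat.rec ⟨k, inferInstance⟩ fun _ T ↦ ⟨@N T.1 T.2, @fieldN T.1 T.2⟩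
  let F (n : ℕ) : Type u := (X n).1
  let _ (n : ℕ) : Field (F n) := (X n).2
  let _ (n : ℕ) : Algebra (F n) (F (n + 1)) := algN (F n)
  have hF (n : ℕ) : IsIntegrallyClosedIn (F n) (F (n + 1)) := closedN (F n)
  obtain ⟨K, _, g, hg, hgK⟩ := exists_direct_limit_nat F fun n ↦ algebraMap (F n) (F (n + 1))
  refine ⟨K, inferInstance, g 0, ?_, ?_⟩
  · intro A _ _ _ hA hAdom
    have := Algebra.FinitePresentation.of_finiteType.1 hA
    let P := Algebra.Presentation.ofFinitePresentation K A
    have hmono : Monotone fun n ↦ (g n).range := monotone_nat_of_le_succ fun n ↦ by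
      rintro _ ⟨x, rfl⟩
      exact ⟨_, hg n x⟩
    choose m hm using hgK
    obtain ⟨n, hn⟩ := (P.finite_coeffs.image m).bddAbove
    let _ : Algebra (F n) K := (g n).toAlgebra
    let _ : Algebra (F n) A := Algebra.compHom A (g n)
    have : IsScalarTower (F n) K A := .of_algebraMap_eq' rfl
    have : P.HasCoeffs (F n) :=
      ⟨fun x hx ↦ hmono (hn (Set.mem_image_of_mem m hx)) (hm x)⟩
    let A₀ := P.ModelOfHasCoeffs (F n)
    let e : K ⊗[F n] A₀ ≃ₐ[K] A := P.tensorModelOfHasCoeffsEquiv (F n)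
    have : IsGeometricallyIntegral K A := hAdom
    have : IsGeometricallyIntegral K (K ⊗[F n] A₀) := .of_algEquiv e.symm
    obtain ⟨φ⟩ := pointN (F n) A₀ inferInstance (.of_baseChange (F n) K A₀)
    let j : F (n + 1) →ₐ[F n] K := { g (n + 1) with commutes' := hg n }
    exact ⟨(Algebra.TensorProduct.lift (AlgHom.id K K) (j.comp φ) fun _ _ ↦ Commute.all _ _).comp
      e.symm.toAlgHom⟩
  · have hι (n : ℕ) : ∃ ι : k →+* F n, (g n).comp ι = g 0 := by
      induction n with
      | zero => exact ⟨RingHom.id k, rfl⟩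
      | succ n ih =>
        obtain ⟨ι, hι⟩ := ih
        refine ⟨(algebraMap (F n) (F (n + 1))).comp ι, ?_⟩
        rw [← hι]
        exact RingHom.ext fun x ↦ hg n (ι x)
    rintro x ⟨p, hp, hpx⟩
    obtain ⟨n, y, rfl⟩ := hgK x
    induction n with
    | zero => exact ⟨y, rfl⟩
    | succ n ih =>
      obtain ⟨ι, hι⟩ := hι n
      have hy : IsAlgebraic (F n) y := by
        refine ⟨p.map ι, (Polynomial.map_ne_zero_iff ι.injective).2 hp, ?_⟩
        apply (g (n + 1)).injective
        rw [Polynomial.aeval_def, Polynomial.eval₂_map, Polynomial.hom_eval₂, map_zero, ← hpx,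
          ← hι]
        congr 1
        exact RingHom.ext fun x ↦ hg n (ι x)
      obtain ⟨z, rfl⟩ := IsIntegrallyClosedIn.isIntegral_iff.1 hy.isIntegral
      rw [hg] at hpx ⊢
      exact ih z hpx
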